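/- Let d ≥ 1, b > 0, let f: ℝ^d → ℝ be twice continuously differentiable with all second-order partial derivatives bounded in sup-norm by b, and let K: ℝ^d → ℝ be a bounded symmetric probability density with ∫ ‖u‖³ K(u) du < ∞ and ∫ |u_i||u_j| K(u) du < ∞ for all i, j. Then for every v ∈ ℝ^d, lim_{h→0⁺} h^{−2} ( ∫_{ℝ^d} K(u) f(v − h u) du − f(v) ) = (1/2) Σ_{i,j=1}^d (∂²f/∂v_i∂v_j)(v) ∫_{ℝ^d} u_i u_j K(u) du. -/

import Mathlib

open MeasureTheory Filter

/-- Second-order partial derivative `∂²f/∂v_i∂v_j (v)`. -/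
noncomputable def pd2 {d : ℕ} (f : EuclideanSpace ℝ (Fin d) → ℝ)
    (v : EuclideanSpace ℝ (Fin d)) (i j : Fin d) : ℝ :=
  iteratedFDeriv ℝ 2 f v ![EuclideanSpace.single i 1, EuclideanSpace.single j 1]

/-- Second-order Taylor formula with Lagrange remainder in one variable. -/
lemma taylor_two_aux (p p' p'' : ℝ → ℝ) (h1 : ∀ t, HasDerivAt p (p' t) t)
    (h2 : ∀ t, HasDerivAt p' (p'' t) t) {h : ℝ} (hh : 0 < h) :
    ∃ c ∈ Set.Ioo 0 h, (p h - p 0 - h * p' 0) / h ^ 2 = p'' c / 2 := by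
  have hF : ∀ t, HasDerivAt (fun t => p t - p 0 - t * p' 0) (p' t - p' 0) t := by
    intro t
    have := ((h1 t).sub_const (p 0)).sub ((hasDerivAt_id t).mul_const (p' 0))
    rw [one_mul] at this
    exact this
  have hG : ∀ t : ℝ, HasDerivAt (fun t : ℝ => t ^ 2) (2 * t) t := by
    intro t
    simpa using hasDerivAt_pow 2 t
  obtain ⟨c, hc, hc'⟩ := exists_ratio_hasDerivAt_eq_ratio_slope _ _ hh
    (fun t _ => (hF t).continuousAt.continuousWithinAt) (fun t _ => hF t) _ _
    (fun t _ => (hG t).continuousAt.continuousWithinAt) (fun t _ => hG t)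
  obtain ⟨x, hx, hx'⟩ := exists_hasDerivAt_eq_slope p' p'' hc.1
    (fun t _ => (h2 t).continuousAt.continuousWithinAt) (fun t _ => h2 t)
  refine ⟨x, ⟨hx.1, hx.2.trans hc.2⟩, ?_⟩
  have hc0 : c ≠ 0 := hc.1.ne'
  rw [sub_zero, eq_div_iff hc0] at hx'
  rw [← hx'] at hc'
  simp only [zero_mul, sub_zero, sub_self] at hc'
  rw [div_eq_div_iff (by positivity) (by norm_num)]
  apply mul_right_cancel₀ hc0
  linear_combination -hc'

/-- The Hessian quadratic form in coordinates. -/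
lemma hess_coord {d : ℕ} (f : EuclideanSpace ℝ (Fin d) → ℝ)
    (x u : EuclideanSpace ℝ (Fin d)) :
    fderiv ℝ (fderiv ℝ f) x u u = ∑ i : Fin d, ∑ j : Fin d, pd2 f x i j * (u i * u j) := by
  have hu : u = ∑ i, u i • EuclideanSpace.single i (1 : ℝ) := by
    ext k
    simp [Finset.sum_apply, Pi.single_apply]
  have hp : ∀ i j, pd2 f x i j = fderiv ℝ (fderiv ℝ f) x (EuclideanSpace.single i 1)
      (EuclideanSpace.single j 1) := by
    intro i j
    simp [pd2, iteratedFDeriv_two_apply]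
  conv_lhs => rw [hu]
  simp only [map_sum, map_smul, sum_apply, smul_apply,
    smul_eq_mul, hp, Finset.mul_sum]
  rw [Finset.sum_comm]
  refine Finset.sum_congr rfl fun i _ => Finset.sum_congr rfl fun j _ => ?_
  ring

/-- Taylor formula along a ray. -/
lemma taylor_ray {d : ℕ} (f : EuclideanSpace ℝ (Fin d) → ℝ) (hf : ContDiff ℝ 2 f)
    (v u : EuclideanSpace ℝ (Fin d)) {h : ℝ} (hh : 0 < h) :
    ∃ c ∈ Set.Ioo 0 h, (f (v - h • u) - f v + h * fderiv ℝ f v u) / h ^ 2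
      = fderiv ℝ (fderiv ℝ f) (v - c • u) u u / 2 := by
  have hl : ∀ t : ℝ, HasDerivAt (fun t : ℝ => v - t • u) (-u) t := by
    intro t
    simpa using ((hasDerivAt_id t).smul_const u).const_sub v
  have hd1 : Differentiable ℝ f := hf.differentiable (by norm_num)
  have hd2 : Differentiable ℝ (fderiv ℝ f) :=
    (hf.fderiv_right (m := 1) (by norm_num)).differentiable (by norm_num)
  have h1 : ∀ t : ℝ, HasDerivAt (fun t : ℝ => f (v - t • u)) (- fderiv ℝ f (v - t • u) u) t := by
    intro t
    have h3 := (hd1 (v - t • u)).hasFDerivAt.comp_hasDerivAt t (hl t)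
    rw [map_neg] at h3
    exact h3
  have h2 : ∀ t : ℝ, HasDerivAt (fun t : ℝ => - fderiv ℝ f (v - t • u) u)
      (fderiv ℝ (fderiv ℝ f) (v - t • u) u u) t := by
    intro t
    have h3 := (hd2 (v - t • u)).hasFDerivAt.comp_hasDerivAt t (hl t)
    have h4 := (h3.clm_apply (hasDerivAt_const t u)).neg
    simp only [map_neg, neg_apply, map_zero, add_zero, neg_neg] at h4
    exact h4
  obtain ⟨c, hc, e⟩ := taylor_two_aux _ _ _ h1 h2 hh
  refine ⟨c, hc, ?_⟩
  rw [← e]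
  simp

/-- Asymptotic bias of the kernel density estimator: for `f` of class `C²` with bounded second
partial derivatives and a bounded symmetric probability density `K` with the stated moment
conditions, `h⁻²(∫ K(u) f(v − hu) du − f(v)) → (1/2) ∑_{i,j} ∂²_{ij}f(v) ∫ u_i u_j K(u) du`
as `h → 0⁺`. -/
theorem kernel_bias_limit
    {d : ℕ} (hd : 1 ≤ d)
    (f : EuclideanSpace ℝ (Fin d) → ℝ)
    (b : ℝ) (hfC2 : ContDiff ℝ 2 f) (hfb : ∀ x i j, |pd2 f x i j| ≤ b)
    (K : EuclideanSpace ℝ (Fin d) → ℝ) (hKmeas : Measurable K) (hKnn : ∀ x, 0 ≤ K x)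
    (hKbdd : ∃ CK : ℝ, ∀ x, K x ≤ CK) (hKprob : ∫ x, K x = 1)
    (hKsymm : ∀ x, K (-x) = K x)
    (hK3 : Integrable fun x => ‖x‖ ^ 3 * K x)
    (hKij : ∀ i j : Fin d, Integrable fun x => |x i| * |x j| * K x)
    (v : EuclideanSpace ℝ (Fin d)) :
    Tendsto (fun h : ℝ => ((∫ u, K u * f (v - h • u)) - f v) / h ^ 2)
      (nhdsWithin 0 (Set.Ioi 0))
      (nhds ((1 / 2 : ℝ) *
        ∑ i : Fin d, ∑ j : Fin d, pd2 f v i j * ∫ u, u i * u j * K u)) := by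
  have hK : Integrable K := by
    by_contra hn
    rw [integral_undef hn] at hKprob
    norm_num at hKprob
  have hd1 : Differentiable ℝ f := hfC2.differentiable (by norm_num)
  have hC2 : Continuous (fderiv ℝ (fderiv ℝ f)) :=
    (hfC2.fderiv_right (m := 1) (by norm_num)).continuous_fderiv (by norm_num)
  have hKij' : ∀ i j : Fin d, Integrable fun x : EuclideanSpace ℝ (Fin d) => x i * x j * K x := by
    intro i j
    refine (hKij i j).mono' (by fun_prop) (ae_of_all _ fun x => ?_)
    rw [Real.norm_eq_abs, abs_mul, abs_mul, abs_of_nonneg (hKnn x)]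
  have hK2 : Integrable fun x : EuclideanSpace ℝ (Fin d) => ‖x‖ ^ 2 * K x := by
    have : Integrable fun x : EuclideanSpace ℝ (Fin d) => ∑ i : Fin d, x i * x i * K x :=
      integrable_finsetSum _ fun i _ => hKij' i i
    refine this.congr (ae_of_all _ fun x => ?_)
    simp only [EuclideanSpace.real_norm_sq_eq, Finset.sum_mul]
    refine Finset.sum_congr rfl fun i _ => ?_
    ring
  set L := fderiv ℝ f v with hL
  have hKL : Integrable fun x => K x * L x := by
    refine ((hK.add hK2).const_mul ‖L‖).mono' (by fun_prop) (ae_of_all _ fun x => ?_)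
    rw [norm_mul, Real.norm_eq_abs, abs_of_nonneg (hKnn x)]
    have a1 := L.le_opNorm x
    have a2 : ‖x‖ ≤ 1 + ‖x‖ ^ 2 := by nlinarith [sq_nonneg (‖x‖ - 1), sq_nonneg ‖x‖]
    calc K x * ‖L x‖ ≤ K x * (‖L‖ * (1 + ‖x‖ ^ 2)) :=
          mul_le_mul_of_nonneg_left (a1.trans (mul_le_mul_of_nonneg_left a2 (norm_nonneg _)))
            (hKnn x)
      _ = ‖L‖ * (K x + ‖x‖ ^ 2 * K x) := by ring
  have hKL0 : ∫ x, K x * L x = 0 := by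
    have e := integral_neg_eq_self (fun x => K x * L x) (volume : Measure (EuclideanSpace ℝ (Fin d)))
    simp only [hKsymm, map_neg, mul_neg, integral_neg] at e
    linarith
  have hbound : ∀ x u, ‖fderiv ℝ (fderiv ℝ f) x u u‖ ≤
      ∑ i : Fin d, ∑ j : Fin d, b * (|u i| * |u j|) := by
    intro x u
    rw [hess_coord]
    refine (norm_sum_le _ _).trans (Finset.sum_le_sum fun i _ => ?_)
    refine (norm_sum_le _ _).trans (Finset.sum_le_sum fun j _ => ?_)
    rw [Real.norm_eq_abs, abs_mul, abs_mul]
    exact mul_le_mul_of_nonneg_right (hfb x i j) (by positivity)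
  let G : ℝ → EuclideanSpace ℝ (Fin d) → ℝ := fun h u =>
    K u * ((f (v - h • u) - f v + h * L u) / h ^ 2)
  let B : EuclideanSpace ℝ (Fin d) → ℝ := fun u =>
    ∑ i : Fin d, ∑ j : Fin d, b / 2 * (|u i| * |u j| * K u)
  have hB : Integrable B := integrable_finsetSum _ fun i _ => integrable_finsetSum _ fun j _ =>
    (hKij i j).const_mul _
  have hGm : ∀ h, AEStronglyMeasurable (G h) volume := by
    intro h
    have := hfC2.continuous
    refine Measurable.aestronglyMeasurable ?_
    refine hKmeas.mul (Continuous.measurable ?_)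
    fun_prop
  have hGB : ∀ h, 0 < h → ∀ u, ‖G h u‖ ≤ B u := by
    intro h hh u
    obtain ⟨c, hc, e⟩ := taylor_ray f hfC2 v u hh
    simp only [G, B, hL, e]
    rw [norm_mul, norm_div, Real.norm_eq_abs, abs_of_nonneg (hKnn u), Real.norm_two]
    calc _ ≤ K u * ((∑ i : Fin d, ∑ j : Fin d, b * (|u i| * |u j|)) / 2) :=
          mul_le_mul_of_nonneg_left (div_le_div_of_nonneg_right (hbound _ u) (by norm_num)) (hKnn u)
      _ = _ := by
          simp only [Finset.sum_div, Finset.mul_sum]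
          refine Finset.sum_congr rfl fun i _ => Finset.sum_congr rfl fun j _ => ?_
          ring
  have hGi : ∀ h, 0 < h → Integrable (G h) := fun h hh =>
    hB.mono' (hGm h) (ae_of_all _ (hGB h hh))
  have hlim : ∀ u, Tendsto (fun h => G h u) (nhdsWithin 0 (Set.Ioi 0))
      (nhds (K u * (fderiv ℝ (fderiv ℝ f) v u u / 2))) := by
    intro u
    refine Tendsto.const_mul _ ?_
    have hex : ∀ h : ℝ, ∃ c : ℝ, 0 < h → c ∈ Set.Ioo 0 h ∧
        (f (v - h • u) - f v + h * L u) / h ^ 2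
          = fderiv ℝ (fderiv ℝ f) (v - c • u) u u / 2 := by
      intro h
      by_cases hh : 0 < h
      · obtain ⟨c, hc, e⟩ := taylor_ray f hfC2 v u hh
        exact ⟨c, fun _ => ⟨hc, e⟩⟩
      · exact ⟨0, fun h' => absurd h' hh⟩
    choose c hc using hex
    have hev : ∀ᶠ h : ℝ in nhdsWithin 0 (Set.Ioi 0), 0 < h := self_mem_nhdsWithin
    have hc0 : Tendsto c (nhdsWithin 0 (Set.Ioi 0)) (nhds 0) := by
      refine tendsto_of_tendsto_of_tendsto_of_le_of_le' tendsto_const_nhds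
        (tendsto_id.mono_left nhdsWithin_le_nhds) ?_ ?_
      · filter_upwards [hev] with h hh using (hc h hh).1.1.le
      · filter_upwards [hev] with h hh using (hc h hh).1.2.le
    have hcont : Continuous fun t : ℝ => fderiv ℝ (fderiv ℝ f) (v - t • u) u u / 2 := by
      fun_prop
    have ht := (hcont.tendsto 0).comp hc0
    simp only [zero_smul, sub_zero] at ht
    refine ht.congr' ?_
    filter_upwards [hev] with h hh using (hc h hh).2.symm
  have hev : ∀ᶠ h : ℝ in nhdsWithin 0 (Set.Ioi 0), 0 < h := self_mem_nhdsWithin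
  have hmain : Tendsto (fun h => ∫ u, G h u) (nhdsWithin 0 (Set.Ioi 0))
      (nhds (∫ u, K u * (fderiv ℝ (fderiv ℝ f) v u u / 2))) := by
    refine tendsto_integral_filter_of_dominated_convergence B (Eventually.of_forall hGm) ?_ hB
      (ae_of_all _ hlim)
    filter_upwards [hev] with h hh using ae_of_all _ (hGB h hh)
  have hval : ∫ u, K u * (fderiv ℝ (fderiv ℝ f) v u u / 2) =
      (1 / 2 : ℝ) * ∑ i : Fin d, ∑ j : Fin d, pd2 f v i j * ∫ u, u i * u j * K u := by
    have e1 : ∀ u, K u * (fderiv ℝ (fderiv ℝ f) v u u / 2) =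
        (1 / 2 : ℝ) * ∑ i : Fin d, ∑ j : Fin d, pd2 f v i j * (u i * u j * K u) := by
      intro u
      rw [hess_coord]
      simp only [Finset.sum_div, Finset.mul_sum]
      refine Finset.sum_congr rfl fun i _ => Finset.sum_congr rfl fun j _ => ?_
      ring
    simp only [e1]
    rw [integral_const_mul, integral_finsetSum _ fun i _ => integrable_finsetSum _ fun j _ =>
      (hKij' i j).const_mul _]
    congr 1
    refine Finset.sum_congr rfl fun i _ => ?_
    rw [integral_finsetSum _ fun j _ => (hKij' i j).const_mul _]
    refine Finset.sum_congr rfl fun j _ => ?_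
    rw [integral_const_mul]
  rw [← hval]
  refine hmain.congr' ?_
  filter_upwards [hev] with h hh
  have hh2 : h ^ 2 ≠ 0 := by positivity
  have e2 : ∀ u, K u * f (v - h • u) = h ^ 2 * G h u + f v * K u - h * (K u * L u) := by
    intro u
    simp only [G]
    field_simp
    ring
  have e3 : ∫ u, K u * f (v - h • u) = h ^ 2 * (∫ u, G h u) + f v := by
    simp only [e2]
    have i1 : Integrable fun u => h ^ 2 * G h u + f v * K u :=
      ((hGi h hh).const_mul _).add (hK.const_mul _)
    rw [integral_sub i1 (hKL.const_mul _),
      integral_add ((hGi h hh).const_mul _) (hK.const_mul _), integral_const_mul,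
      integral_const_mul, integral_const_mul, hKL0, hKprob]
    ring
  rw [e3]
  field_simp
  ring
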